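/- Let f be convex with L_f-Lipschitz continuous gradient on X and satisfy the quadratic functional growth condition on X with constant κ_f > 0, and let μ_f = κ_f/L_f. The projected gradient iterates x^{k+1} = [x^k − (1/L_f)∇f(x^k)]_X, started from x^0 ∈ X, satisfy for all k ≥ 1 the linear convergence rate in function values f(x^k) − f* ≤ (L_f‖x^0 − [x^0]_{X*}‖²/2)·(1/(1 + μ_f))^{k−1}. -/

import Mathlib

open Set
open scoped InnerProductSpace

section ProjectedGradient

variable {E : Type*} [NormedAddCommGroup E] [InnerProductSpace ℝ E]

/-- The variational inequality satisfied by a nearest point of a convex set. -/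
theorem inner_sub_nearest_le_zero {X : Set E} (hX : Convex ℝ X) {u p : E} (hp : p ∈ X)
    (hmin : ∀ y ∈ X, ‖u - p‖ ≤ ‖u - y‖) {y : E} (hy : y ∈ X) : ⟪u - p, y - p⟫_ℝ ≤ 0 := by
  have : Nonempty X := ⟨⟨p, hp⟩⟩
  refine (norm_eq_iInf_iff_real_inner_le_zero hX hp).1 (le_antisymm ?_ ?_) y hy
  · exact le_ciInf fun w => hmin w w.2
  · exact ciInf_le (f := fun w : X => ‖u - w‖)
      ⟨0, forall_mem_range.2 fun _ => norm_nonneg _⟩ ⟨p, hp⟩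

variable [CompleteSpace E]

theorem HasGradientAt.hasDerivAt_comp_add_smul {f : E → ℝ} {x v g : E} {t : ℝ}
    (h : HasGradientAt f g (x + t • v)) :
    HasDerivAt (fun s : ℝ => f (x + s • v)) ⟪g, v⟫_ℝ t := by
  have hline : HasDerivAt (fun s : ℝ => x + s • v) v t := by
    simpa using ((hasDerivAt_id t).smul_const v).const_add x
  simpa [Function.comp_def] using h.hasFDerivAt.comp_hasDerivAt t hline

/-- The gradient inequality for convex functions. -/
theorem ConvexOn.add_inner_gradient_le {f : E → ℝ} (hf : ConvexOn ℝ univ f) {x g : E}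
    (hg : HasGradientAt f g x) (y : E) : f x + ⟪g, y - x⟫_ℝ ≤ f y := by
  have hconv : ConvexOn ℝ univ (fun s : ℝ => f (x + s • (y - x))) := by
    have := hf.comp_affineMap (AffineMap.lineMap x y : ℝ →ᵃ[ℝ] E)
    simpa [Function.comp_def, AffineMap.lineMap_apply, add_comm] using this
  have hder : HasDerivAt (fun s : ℝ => f (x + s • (y - x))) ⟪g, y - x⟫_ℝ 0 :=
    HasGradientAt.hasDerivAt_comp_add_smul (by simpa using hg)
  have := hconv.le_slope_of_hasDerivAt (mem_univ 0) (mem_univ 1) one_pos hder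
  simp [slope_def_field] at this
  linarith

/-- The descent lemma on a convex set where the gradient is Lipschitz continuous. -/
theorem le_add_inner_gradient_add_sq {X : Set E} (hX : Convex ℝ X) {f : E → ℝ} {f' : E → E}
    (hgrad : ∀ x ∈ X, HasGradientAt f (f' x) x) {L : ℝ}
    (hLip : ∀ x ∈ X, ∀ y ∈ X, ‖f' x - f' y‖ ≤ L * ‖x - y‖) {x y : E} (hx : x ∈ X) (hy : y ∈ X) :
    f y ≤ f x + ⟪f' x, y - x⟫_ℝ + L / 2 * ‖y - x‖ ^ 2 := by
  set v := y - x with hv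
  have hmem : ∀ t ∈ Icc (0 : ℝ) 1, x + t • v ∈ X := fun t ht => hX.add_smul_sub_mem hx hy ht
  have hder : ∀ t ∈ Icc (0 : ℝ) 1,
      HasDerivAt (fun s : ℝ => f (x + s • v) - s * ⟪f' x, v⟫_ℝ - L / 2 * ‖v‖ ^ 2 * s ^ 2)
        (⟪f' (x + t • v), v⟫_ℝ - ⟪f' x, v⟫_ℝ - L * ‖v‖ ^ 2 * t) t := by
    intro t ht
    have h := ((hgrad _ (hmem t ht)).hasDerivAt_comp_add_smul.sub
      ((hasDerivAt_id t).mul_const ⟪f' x, v⟫_ℝ)).sub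
        ((hasDerivAt_pow 2 t).const_mul (L / 2 * ‖v‖ ^ 2))
    refine h.congr_deriv ?_
    norm_num
    ring
  have hanti := antitoneOn_of_deriv_nonpos (convex_Icc (0 : ℝ) 1)
    (fun t ht => (hder t ht).continuousAt.continuousWithinAt)
    (fun t ht => (hder t (interior_subset ht)).differentiableAt.differentiableWithinAt)
    (fun t ht => by
      have ht' := interior_subset ht
      rw [(hder t ht').deriv, ← inner_sub_left]
      have h1 := hLip _ (hmem t ht') x hx
      rw [add_sub_cancel_left, norm_smul, Real.norm_of_nonneg ht'.1] at h1
      have h2 := real_inner_le_norm (f' (x + t • v) - f' x) v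
      have h3 := mul_le_mul_of_nonneg_right h1 (norm_nonneg v)
      linarith)
  have h := hanti (left_mem_Icc.2 zero_le_one) (right_mem_Icc.2 zero_le_one) zero_le_one
  simp [hv] at h
  rw [hv]
  linarith

/-- The three-point inequality for one projected gradient step of length `1 / L`. -/
theorem projected_gradient_step_le {X : Set E} (hX : Convex ℝ X) {f : E → ℝ} {f' : E → E}
    (hf : ConvexOn ℝ univ f) (hgrad : ∀ x ∈ X, HasGradientAt f (f' x) x) {L : ℝ} (hL : 0 < L)
    (hLip : ∀ x ∈ X, ∀ y ∈ X, ‖f' x - f' y‖ ≤ L * ‖x - y‖) {x p y : E} (hx : x ∈ X) (hp : p ∈ X)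
    (hmin : ∀ z ∈ X, ‖x - (1 / L) • f' x - p‖ ≤ ‖x - (1 / L) • f' x - z‖) (hy : y ∈ X) :
    f p ≤ f y + L / 2 * (‖x - y‖ ^ 2 - ‖p - y‖ ^ 2) := by
  have hvar := inner_sub_nearest_le_zero hX hp hmin hy
  rw [sub_right_comm, inner_sub_left, real_inner_smul_left, sub_nonpos, one_div,
    inv_mul_eq_div, le_div_iff₀ hL] at hvar
  have hdesc := le_add_inner_gradient_add_sq hX hgrad hLip hx hp
  have hgi := hf.add_inner_gradient_le (hgrad x hx) y
  have hsplit : ⟪f' x, y - x⟫_ℝ = ⟪f' x, y - p⟫_ℝ + ⟪f' x, p - x⟫_ℝ := by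
    rw [← inner_add_right, sub_add_sub_cancel]
  have hnorm := norm_sub_sq_real (x - p) (y - p)
  rw [sub_sub_sub_cancel_right] at hnorm
  rw [norm_sub_rev p x] at hdesc
  rw [hnorm, norm_sub_rev p y]
  linarith

end ProjectedGradient

/-- Linear convergence in function values of the projected gradient method under quadratic
functional growth: f(xᵏ) - f* ≤ (Lf‖x⁰ - x̄⁰‖²/2)·(1/(1+μ))^{k-1} for all k ≥ 1. -/
theorem gm_linear_convergence_function_values_quadratic_functional_growth
    {n : ℕ} (X Xstar : Set (EuclideanSpace ℝ (Fin n)))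
    (f : EuclideanSpace ℝ (Fin n) → ℝ)
    (f' proj projX : EuclideanSpace ℝ (Fin n) → EuclideanSpace ℝ (Fin n))
    (fstar Lf κ : ℝ)
    -- X is a nonempty closed convex set
    (hXne : X.Nonempty) (hXclosed : IsClosed X) (hXconv : Convex ℝ X)
    -- f is convex and continuously differentiable, with gradient f'
    (hconv : ConvexOn ℝ univ f)
    (hsmooth : ContDiff ℝ 1 f)
    (hgrad : ∀ x, HasGradientAt f (f' x) x)
    -- the gradient of f is Lipschitz continuous on X with constant Lf > 0
    (hLf : 0 < Lf)
    (hLip : ∀ x ∈ X, ∀ y ∈ X, ‖f' x - f' y‖ ≤ Lf * ‖x - y‖)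
    -- Xstar is the (nonempty, closed) set of minimizers of f over X, with optimal value fstar
    (hXstar : Xstar = {x ∈ X | ∀ y ∈ X, f x ≤ f y})
    (hXstar_ne : Xstar.Nonempty) (hXstar_closed : IsClosed Xstar)
    (hfstar : ∀ x ∈ Xstar, f x = fstar)
    -- proj is the Euclidean projection onto Xstar
    (hproj : ∀ x, proj x ∈ Xstar ∧ ∀ y ∈ Xstar, ‖x - proj x‖ ≤ ‖x - y‖)
    -- projX is the Euclidean projection onto X
    (hprojX : ∀ u, projX u ∈ X ∧ ∀ y ∈ X, ‖u - projX u‖ ≤ ‖u - y‖)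
    (hκ : 0 < κ)
    -- f has quadratic functional growth on X with constant κ
    (hqfg : ∀ x ∈ X, f x - fstar ≥ κ / 2 * ‖x - proj x‖ ^ 2)
    -- projected gradient iterates with constant stepsize 1/Lf, started from x⁰ ∈ X
    (x : ℕ → EuclideanSpace ℝ (Fin n))
    (hx0 : x 0 ∈ X)
    (hiter : ∀ k, x (k + 1) = projX (x k - (1 / Lf) • f' (x k)))
    :
    ∀ k : ℕ, 1 ≤ k → f (x k) - fstar ≤
      Lf * ‖x 0 - proj (x 0)‖ ^ 2 / 2 * (1 / (1 + κ / Lf)) ^ (k - 1) := by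
  have hsub : ∀ z ∈ Xstar, z ∈ X := fun z hz => by rw [hXstar] at hz; exact hz.1
  have hxX : ∀ k, x k ∈ X
    | 0 => hx0
    | k + 1 => by rw [hiter]; exact (hprojX _).1
  have hstep : ∀ k, f (x (k + 1)) - fstar ≤
      Lf / 2 * (‖x k - proj (x k)‖ ^ 2 - ‖x (k + 1) - proj (x (k + 1))‖ ^ 2) := by
    intro k
    have hmem := (hproj (x k)).1
    have hthree := projected_gradient_step_le hXconv hconv (fun z _ => hgrad z) hLf hLip (hxX k)
      (hxX (k + 1)) (by rw [hiter]; exact (hprojX _).2) (hsub _ hmem)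
    rw [hfstar _ hmem] at hthree
    have hdist : ‖x (k + 1) - proj (x (k + 1))‖ ^ 2 ≤ ‖x (k + 1) - proj (x k)‖ ^ 2 :=
      pow_le_pow_left₀ (norm_nonneg _) ((hproj _).2 _ hmem) 2
    have := mul_le_mul_of_nonneg_left hdist (half_pos hLf).le
    linarith
  have hq : 0 < 1 + κ / Lf := by positivity
  have hdist : ∀ k, ‖x k - proj (x k)‖ ^ 2 ≤
      ‖x 0 - proj (x 0)‖ ^ 2 * (1 / (1 + κ / Lf)) ^ k := by
    intro k
    induction k with
    | zero => simp
    | succ k ih =>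
      have hcontr : ‖x (k + 1) - proj (x (k + 1))‖ ^ 2 ≤
          ‖x k - proj (x k)‖ ^ 2 * (1 / (1 + κ / Lf)) := by
        rw [mul_one_div, le_div_iff₀ hq, mul_add, mul_one, mul_div_assoc', ← le_sub_iff_add_le',
          div_le_iff₀ hLf]
        have := hstep k
        have := hqfg _ (hxX (k + 1))
        linarith
      rw [pow_succ _ k, ← mul_assoc]
      exact hcontr.trans (mul_le_mul_of_nonneg_right ih (by positivity))
  intro k hk
  obtain ⟨k, rfl⟩ := Nat.exists_eq_add_of_le' hk
  rw [Nat.add_sub_cancel]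
  have hlast := mul_le_mul_of_nonneg_left (hdist k) (half_pos hLf).le
  have hnonneg := mul_nonneg (half_pos hLf).le (sq_nonneg ‖x (k + 1) - proj (x (k + 1))‖)
  linarith [hstep k]
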